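/- Let τ be in the complex upper half-plane, set q = e^{2πiτ}, and let u ∈ ℂ with u ∉ 2ℤτ + (1/2)ℤ, z = e^{2πiu}. Then N*(1,1/q,z;q²) = (1/(1+z)) ( −2i e^{πiu} e^{−πiτ/2} μ(u, τ; 2τ) + 1 ). -/

import Mathlib

open Complex Real Filter

noncomputable section

/-- The Jacobi theta function ϑ(u;τ) = Σ_{ν∈ℤ+1/2} e^{πiν²τ + 2πiν(u+1/2)}. -/
def jTheta (u τ : ℂ) : ℂ :=
  ∑' n : ℤ, Complex.exp (π * I * ((n : ℂ) + 1/2)^2 * τ + 2 * π * I * ((n : ℂ) + 1/2) * (u + 1/2))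

/-- ϑ₀(u;τ) = Σ_{n∈ℤ} e^{πin²τ + 2πinu}. -/
def jTheta0 (u τ : ℂ) : ℂ :=
  ∑' n : ℤ, Complex.exp (π * I * (n : ℂ)^2 * τ + 2 * π * I * (n : ℂ) * u)

/-- ϑ₁(u;τ) = Σ_{n∈1/2+ℤ} e^{πin²τ + 2πinu}. -/
def jTheta1 (u τ : ℂ) : ℂ :=
  ∑' n : ℤ, Complex.exp (π * I * ((n : ℂ) + 1/2)^2 * τ + 2 * π * I * ((n : ℂ) + 1/2) * u)

/-- The Dedekind eta function. -/
def dedekindEta (τ : ℂ) : ℂ :=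
  Complex.exp (π * I * τ / 12) * ∏' n : ℕ, (1 - Complex.exp (2 * π * I * ((n : ℂ) + 1) * τ))

/-- The Lerch sum μ(u,v;τ). -/
def lerchMu (u v τ : ℂ) : ℂ :=
  Complex.exp (π * I * u) / jTheta v τ *
    ∑' n : ℤ, (-1 : ℂ) ^ n * Complex.exp (π * I * ((n : ℂ)^2 + (n : ℂ)) * τ + 2 * π * I * v * (n : ℂ)) /
      (1 - Complex.exp (2 * π * I * (n : ℂ) * τ + 2 * π * I * u))

/-- a₀^{α,β}(τ). -/
def aCoef0 (α β : ℝ) (τ : ℂ) : ℂ :=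
  ∑' n : ℤ, ((n : ℂ) + (α : ℂ)/2) *
    Complex.exp (2 * π * I * (n : ℂ)^2 * τ + 2 * π * I * (n : ℂ) * ((α : ℂ) * τ + (β : ℂ)))

/-- a₁^{α,β}(τ). -/
def aCoef1 (α β : ℝ) (τ : ℂ) : ℂ :=
  ∑' n : ℤ, (((n : ℂ) + 1/2) + (α : ℂ)/2) *
    Complex.exp (2 * π * I * ((n : ℂ) + 1/2)^2 * τ + 2 * π * I * ((n : ℂ) + 1/2) * ((α : ℂ) * τ + (β : ℂ)))

/-- Finite q-Pochhammer symbol (a;q)_n. -/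
def qPochN (a q : ℂ) (n : ℕ) : ℂ := ∏ j ∈ Finset.range n, (1 - a * q ^ j)

/-- Infinite q-Pochhammer symbol (a;q)_∞. -/
def qPochInf (a q : ℂ) : ℂ := ∏' j : ℕ, (1 - a * q ^ j)

/-- The modified rank generating function R*(z;q). -/
def rankStar (z q : ℂ) : ℂ :=
  (qPochInf q q)⁻¹ * ∑' n : ℤ, (-1 : ℂ) ^ n * q ^ (n * (3 * n + 1) / 2) / (1 - z * q ^ n)

/-- The modified crank generating function C*(z;q). -/
def crankStar (z q : ℂ) : ℂ :=
  (1 - z)⁻¹ * ∏' n : ℕ, ((1 - q ^ (n + 1)) / ((1 - z * q ^ (n + 1)) * (1 - z⁻¹ * q ^ (n + 1))))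

/-- N(1,0,z;q), the overpartition-rank generating function. -/
def nGen10 (z q : ℂ) : ℂ :=
  ∑' n : ℕ, qPochN (-1) q n * q ^ (n * (n + 1) / 2) / (qPochN (z * q) q n * qPochN (z⁻¹ * q) q n)

/-- N*(1,0,z;q). -/
def nStar10 (z q : ℂ) : ℂ := nGen10 z q / (1 - z)

/-- N(1,1/q,z;q²), the M2-rank generating function for overpartitions. -/
def nGenM2over (z q : ℂ) : ℂ :=
  ∑' n : ℕ, qPochN (-1) (q^2) n * qPochN (-q) (q^2) n * q ^ n /
    (qPochN (z * q^2) (q^2) n * qPochN (z⁻¹ * q^2) (q^2) n)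

/-- N*(1,1/q,z;q²). -/
def nStarM2over (z q : ℂ) : ℂ := nGenM2over z q / (1 - z)

/-- N(0,1/q,z;q²), the M2-rank generating function for partitions without repeated odd parts. -/
def nGenM2 (z q : ℂ) : ℂ :=
  ∑' n : ℕ, qPochN (-q) (q^2) n * q ^ (n^2) /
    (qPochN (z * q^2) (q^2) n * qPochN (z⁻¹ * q^2) (q^2) n)

/-- N*(0,1/q,z;q²). -/
def nStarM2 (z q : ℂ) : ℂ := nGenM2 z q / (1 - z)

/-- The odd-rank generating function R^o(z;q). -/
def oddRank (z q : ℂ) : ℂ :=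
  (qPochInf (q^2) (q^2))⁻¹ * ∑' n : ℤ, (-1 : ℂ) ^ n * q ^ (3 * n^2 + 3 * n + 1) / (1 - z * q ^ (2 * n + 1))


/-- The reciprocal `1 / (q²;q²)_m`, extended by zero to negative `m`. -/
def recipPoch (q : ℂ) (m : ℤ) : ℂ := if m < 0 then 0 else (qPochN (q ^ 2) (q ^ 2) m.toNat)⁻¹

/-- The weight `(-1;q²)_n (-q;q²)_n q^n`. -/
def m2Weight (q : ℂ) (n : ℕ) : ℂ := qPochN (-1) (q ^ 2) n * qPochN (-q) (q ^ 2) n * q ^ n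

/-- The kernel `1 / ((q²;q²)_{n-r} (q²;q²)_{n+r})`. -/
def baileyKernel (q : ℂ) (n : ℕ) (r : ℤ) : ℂ := recipPoch q (n - r) * recipPoch q (n + r)

/-- The weighted column sum of the kernel. -/
def columnSum (q : ℂ) (r : ℤ) : ℂ := ∑' n : ℕ, m2Weight q n * baileyKernel q n r

lemma recipPoch_of_neg (q : ℂ) {m : ℤ} (hm : m < 0) : recipPoch q m = 0 := if_pos hm

lemma recipPoch_zero (q : ℂ) : recipPoch q 0 = 1 := by simp [recipPoch, qPochN]

lemma one_sub_zpow_ne_zero {q : ℂ} (hq1 : ‖q‖ < 1) {m : ℤ} (hm : m ≠ 0) :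
    1 - q ^ m ≠ 0 := by
  intro h
  have h1 : ‖q‖ ^ m = 1 := by rw [← norm_zpow, ← sub_eq_zero.mp h, norm_one]
  rw [zpow_eq_one_iff_right₀ (norm_nonneg q) hq1.ne] at h1
  exact hm h1

lemma one_add_zpow_two_mul_ne_zero {q : ℂ} (hq0 : q ≠ 0) (hq1 : ‖q‖ < 1) (m : ℤ) :
    1 + q ^ (2 * m) ≠ 0 := by
  rcases eq_or_ne m 0 with rfl | hm
  · norm_num
  · intro h
    refine one_sub_zpow_ne_zero hq1 (m := 4 * m) (by omega) ?_
    have h4 : q ^ (4 * m) = q ^ (2 * m) * q ^ (2 * m) := by rw [← zpow_add₀ hq0]; ring_nf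
    rw [h4]
    linear_combination (1 - q ^ (2 * m)) * h

lemma recipPoch_sub_one {q : ℂ} (hq1 : ‖q‖ < 1) (m : ℤ) :
    recipPoch q (m - 1) = (1 - q ^ (2 * m)) * recipPoch q m := by
  rcases lt_trichotomy m 0 with hm | rfl | hm
  · rw [recipPoch_of_neg q hm, recipPoch_of_neg q (by omega), mul_zero]
  · rw [recipPoch_of_neg q (by omega)]; simp
  · obtain ⟨k, rfl⟩ : ∃ k : ℕ, m = k + 1 := ⟨(m - 1).toNat, by omega⟩
    have h := one_sub_zpow_ne_zero hq1 (m := 2 * ((k : ℤ) + 1)) (by omega)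
    have hk : ((k : ℤ) + 1).toNat = k + 1 := by omega
    have hpow : q ^ 2 * (q ^ 2) ^ k = q ^ (2 * ((k : ℤ) + 1)) := by
      rw [← pow_succ', ← pow_mul, ← zpow_natCast]; norm_cast
    simp only [recipPoch, add_sub_cancel_right, qPochN, hk, Finset.prod_range_succ,
      Int.toNat_natCast, if_neg (show ¬ ((k : ℤ) < 0) by omega),
      if_neg (show ¬ ((k : ℤ) + 1 < 0) by omega), hpow]
    rw [mul_inv, mul_comm, mul_assoc, inv_mul_cancel₀ h, mul_one]

lemma exists_norm_prod_one_add_le {f : ℕ → ℂ} (hf : Summable fun n => ‖f n‖) :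
    ∃ K : ℝ, ∀ n, ‖∏ i ∈ Finset.range n, (1 + f i)‖ ≤ K := by
  refine ⟨Real.exp (∑' n, ‖f n‖), fun n => ?_⟩
  have h1 := (Finset.range n).norm_prod_one_add_sub_one_le f
  have h2 : Real.exp (∑ i ∈ Finset.range n, ‖f i‖) ≤ Real.exp (∑' n, ‖f n‖) :=
    Real.exp_le_exp.mpr (hf.sum_le_tsum _ fun _ _ => norm_nonneg _)
  have h3 := norm_add_le (∏ i ∈ Finset.range n, (1 + f i) - 1) 1
  rw [sub_add_cancel, norm_one] at h3
  linarith

lemma exists_norm_qPochN_le (a : ℂ) {Q : ℂ} (hQ : ‖Q‖ < 1) :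
    ∃ K : ℝ, ∀ n, ‖qPochN a Q n‖ ≤ K := by
  have hs : Summable fun n : ℕ => ‖-(a * Q ^ n)‖ := by
    simpa [norm_mul, norm_pow] using
      (summable_geometric_of_lt_one (norm_nonneg Q) hQ).mul_left ‖a‖
  obtain ⟨K, hK⟩ := exists_norm_prod_one_add_le hs
  exact ⟨K, fun n => by simpa only [qPochN, sub_eq_add_neg] using hK n⟩

lemma exists_norm_qPochN_inv_le {Q : ℂ} (hQ : ‖Q‖ < 1) :
    ∃ K : ℝ, ∀ n, ‖(qPochN Q Q n)⁻¹‖ ≤ K := by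
  have hlow (n : ℕ) : 1 - ‖Q‖ ≤ ‖1 - Q * Q ^ n‖ := by
    have h1 := norm_sub_norm_le 1 (Q * Q ^ n)
    have h2 : ‖Q * Q ^ n‖ ≤ ‖Q‖ := by
      rw [norm_mul, norm_pow]
      exact mul_le_of_le_one_right (norm_nonneg Q) (pow_le_one₀ (norm_nonneg Q) hQ.le)
    rw [norm_one] at h1
    linarith
  have hpos (n : ℕ) : 0 < ‖1 - Q * Q ^ n‖ := (sub_pos.mpr hQ).trans_le (hlow n)
  have hs : Summable fun n : ℕ => ‖Q * Q ^ n / (1 - Q * Q ^ n)‖ := by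
    refine Summable.of_nonneg_of_le (fun _ => norm_nonneg _) (fun n => ?_)
      (((summable_geometric_of_lt_one (norm_nonneg Q) hQ).mul_left ‖Q‖).div_const (1 - ‖Q‖))
    rw [norm_div, norm_mul, norm_pow]
    have := sub_pos.mpr hQ
    gcongr
    exact hlow n
  obtain ⟨K, hK⟩ := exists_norm_prod_one_add_le hs
  refine ⟨K, fun n => ?_⟩
  convert hK n using 2
  rw [qPochN, ← Finset.prod_inv_distrib]
  refine Finset.prod_congr rfl fun i _ => ?_
  have := norm_pos_iff.mp (hpos i)
  field_simp
  ring

lemma norm_sq_lt_one {q : ℂ} (hq1 : ‖q‖ < 1) : ‖q ^ 2‖ < 1 := by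
  rw [norm_pow]; exact pow_lt_one₀ (norm_nonneg q) hq1 two_ne_zero

lemma exists_norm_recipPoch_le {q : ℂ} (hq1 : ‖q‖ < 1) :
    ∃ K : ℝ, 0 ≤ K ∧ ∀ m, ‖recipPoch q m‖ ≤ K := by
  obtain ⟨K, hK⟩ := exists_norm_qPochN_inv_le (norm_sq_lt_one hq1)
  have hK0 : 0 ≤ K := (norm_nonneg _).trans (hK 0)
  refine ⟨K, hK0, fun m => ?_⟩
  rw [recipPoch]; split_ifs
  · simpa using hK0
  · exact hK _

lemma exists_norm_baileyKernel_le {q : ℂ} (hq1 : ‖q‖ < 1) :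
    ∃ K : ℝ, ∀ n r, ‖baileyKernel q n r‖ ≤ K := by
  obtain ⟨K, hK0, hK⟩ := exists_norm_recipPoch_le hq1
  exact ⟨K * K, fun n r => by
    rw [baileyKernel, norm_mul]; exact mul_le_mul (hK _) (hK _) (norm_nonneg _) hK0⟩

lemma summable_m2Weight {q : ℂ} (hq1 : ‖q‖ < 1) : Summable fun n => ‖m2Weight q n‖ := by
  obtain ⟨K, hK⟩ := exists_norm_qPochN_le (-1) (norm_sq_lt_one hq1)
  obtain ⟨M, hM⟩ := exists_norm_qPochN_le (-q) (norm_sq_lt_one hq1)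
  refine Summable.of_nonneg_of_le (fun _ => norm_nonneg _) (fun n => ?_)
    ((summable_geometric_of_lt_one (norm_nonneg q) hq1).mul_left (K * M))
  rw [m2Weight, norm_mul, norm_mul, norm_pow]
  have := (norm_nonneg _).trans (hK n)
  gcongr
  exacts [hK n, hM n]

lemma summable_mul_baileyKernel {q : ℂ} (hq1 : ‖q‖ < 1) {s : ℤ → ℂ} (hs : Summable s) (n : ℕ) :
    Summable fun r => s r * baileyKernel q n r := by
  obtain ⟨K, hK⟩ := exists_norm_baileyKernel_le hq1
  refine Summable.of_norm_bounded (hs.norm.mul_right K) fun r => ?_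
  rw [norm_mul]
  gcongr
  exact hK n r

lemma tsum_m2Weight_mul_tsum {q : ℂ} (hq1 : ‖q‖ < 1) {s : ℤ → ℂ} (hs : Summable s) :
    ∑' n, m2Weight q n * ∑' r, s r * baileyKernel q n r = ∑' r, s r * columnSum q r := by
  obtain ⟨K, hK⟩ := exists_norm_baileyKernel_le hq1
  have hsum : Summable (Function.uncurry fun (n : ℕ) (r : ℤ) =>
      m2Weight q n * (s r * baileyKernel q n r)) := by
    refine Summable.of_norm_bounded
      (((summable_m2Weight hq1).mul_of_nonneg hs.norm (fun _ => norm_nonneg _)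
        fun _ => norm_nonneg _).mul_right K) fun p => ?_
    rw [Function.uncurry, norm_mul, norm_mul, ← mul_assoc]
    gcongr
    exact hK _ _
  simp_rw [columnSum, ← tsum_mul_left]
  rw [← hsum.tsum_comm]
  exact tsum_congr fun r => tsum_congr fun n => by ring

lemma m2Weight_succ (q : ℂ) (n : ℕ) :
    m2Weight q (n + 1) = m2Weight q n * ((1 + q ^ (2 * n)) * (1 + q * q ^ (2 * n)) * q) := by
  simp only [m2Weight, qPochN, Finset.prod_range_succ, pow_succ, pow_mul]
  ring

lemma summable_m2Weight_mul {q : ℂ} (hq1 : ‖q‖ < 1) (a b : ℕ → ℤ) :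
    Summable fun n => m2Weight q n * (recipPoch q (a n) * recipPoch q (b n)) := by
  obtain ⟨K, hK0, hK⟩ := exists_norm_recipPoch_le hq1
  refine Summable.of_norm_bounded ((summable_m2Weight hq1).mul_right (K * K)) fun n => ?_
  rw [norm_mul, norm_mul]
  gcongr
  exacts [hK _, hK _]

lemma columnSum_succ {q : ℂ} (hq0 : q ≠ 0) (hq1 : ‖q‖ < 1) (r : ℤ) :
    (1 + q ^ (2 * (r + 1))) * columnSum q (r + 1) = q * (1 + q ^ (2 * r)) * columnSum q r := by
  have hT (r : ℤ) : Summable fun n => m2Weight q n * baileyKernel q n r :=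
    summable_m2Weight_mul hq1 _ _
  let G (n : ℕ) : ℂ := m2Weight q n * (recipPoch q (n - r - 1) * recipPoch q (n + r))
  have hG : Summable G := summable_m2Weight_mul hq1 _ _
  have hG0 : G 0 = 0 := by
    simp only [G, Nat.cast_zero, zero_sub, zero_add]
    rcases lt_or_ge r 0 with h | h
    · rw [recipPoch_of_neg q h]; ring
    · rw [recipPoch_of_neg q (by omega : -r - 1 < 0)]; ring
  have hshift : ∑' n, G (n + 1) = ∑' n, G n := by rw [hG.tsum_eq_zero_add, hG0, zero_add]
  have hterm (n : ℕ) : (1 + q ^ (2 * (r + 1))) * (m2Weight q n * baileyKernel q n (r + 1)) -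
      q * (1 + q ^ (2 * r)) * (m2Weight q n * baileyKernel q n r) =
      (q * q ^ (2 * r) - 1) * (G (n + 1) - G n) := by
    have e1 := recipPoch_sub_one hq1 (n - r)
    have e2 := recipPoch_sub_one hq1 (n + r + 1)
    have c1 : ((n + 1 : ℕ) : ℤ) - r - 1 = n - r := by push_cast; ring
    have c2 : ((n + 1 : ℕ) : ℤ) + r = n + r + 1 := by push_cast; ring
    have c3 : (n : ℤ) - (r + 1) = n - r - 1 := by ring
    have p1 : q ^ (2 * ((n : ℤ) - r)) = q ^ (2 * n) / q ^ (2 * r) := by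
      rw [mul_sub, zpow_sub₀ hq0]; norm_cast
    have p2 : q ^ (2 * ((n : ℤ) + r + 1)) = q ^ (2 * n) * q ^ (2 * r) * q ^ 2 := by
      rw [mul_add, mul_add, zpow_add₀ hq0, zpow_add₀ hq0]; norm_cast
    have p3 : q ^ (2 * (r + 1)) = q ^ (2 * r) * q ^ 2 := by
      rw [mul_add, zpow_add₀ hq0]; norm_cast
    rw [add_sub_cancel_right, p2] at e2
    rw [p1] at e1
    simp only [G, baileyKernel, c1, c2, c3, ← add_assoc, e1, e2, m2Weight_succ, p3]
    have hR : q ^ (2 * r) ≠ 0 := zpow_ne_zero _ hq0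
    generalize q ^ (2 * r) = R at hR
    generalize q ^ (2 * n) = N
    field_simp
    ring
  rw [← sub_eq_zero, columnSum, columnSum, ← tsum_mul_left, ← tsum_mul_left,
    ← ((hT _).mul_left _).tsum_sub ((hT _).mul_left _), tsum_congr hterm, tsum_mul_left,
    ((summable_nat_add_iff 1).mpr hG).tsum_sub hG, hshift, sub_self, mul_zero]

lemma columnSum_eq {q : ℂ} (hq0 : q ≠ 0) (hq1 : ‖q‖ < 1) (r : ℤ) :
    columnSum q r = columnSum q 0 * (2 * q ^ r / (1 + q ^ (2 * r))) := by
  have hne := one_add_zpow_two_mul_ne_zero hq0 hq1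
  suffices h : (1 + q ^ (2 * r)) * columnSum q r = 2 * q ^ r * columnSum q 0 by
    field_simp [hne r]
    linear_combination h
  induction r with
  | zero => norm_num
  | succ i ih =>
    rw [columnSum_succ hq0 hq1, zpow_add_one₀ hq0]
    linear_combination q * ih
  | pred i ih =>
    have h := columnSum_succ hq0 hq1 (-(i : ℤ) - 1)
    rw [sub_add_cancel, ih] at h
    have hp : q ^ (-(i : ℤ)) = q ^ (-(i : ℤ) - 1) * q := by rw [← zpow_add_one₀ hq0, sub_add_cancel]
    rw [hp] at h
    refine mul_left_cancel₀ hq0 ?_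
    linear_combination -h

/-- The theta-type term `(-1)^r q^{r² + ar}`. -/
def thetaTerm (q : ℂ) (a r : ℤ) : ℂ := (-1) ^ r * q ^ (r ^ 2 + a * r)

lemma summable_thetaTerm {q : ℂ} (hq0 : q ≠ 0) (hq1 : ‖q‖ < 1) (a : ℤ) :
    Summable (thetaTerm q a) := by
  have hg : Summable fun r : ℤ => ‖q‖ ^ |r| := by
    have := summable_geometric_of_lt_one (norm_nonneg q) hq1
    exact Summable.of_nat_of_neg (by simpa using this) (by simpa using this)
  refine Summable.of_norm_bounded (hg.mul_left (‖q‖ ^ (-(|a| + 1) ^ 2))) fun r => ?_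
  have hq := norm_pos_iff.mpr hq0
  rw [thetaTerm, norm_mul, norm_zpow, norm_zpow, norm_neg, norm_one, one_zpow, one_mul,
    ← zpow_add₀ hq.ne']
  refine zpow_le_zpow_right_of_le_one₀ hq hq1.le ?_
  have h1 := neg_abs_le (a * r)
  rw [abs_mul] at h1
  have h2 := abs_nonneg r
  have h3 := abs_nonneg a
  rw [← sq_abs r]
  rcases le_total |r| (|a| + 1) with h | h <;> nlinarith

lemma thetaTerm_add {q : ℂ} (hq0 : q ≠ 0) {a b c : ℤ} (h : a + b = c) (r : ℤ) :
    thetaTerm q c r = thetaTerm q a r * q ^ (b * r) := by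
  rw [← h, thetaTerm, thetaTerm, mul_assoc, ← zpow_add₀ hq0]; ring_nf

lemma thetaTerm_neg (q : ℂ) (a r : ℤ) : thetaTerm q a (-r) = thetaTerm q (-a) r := by
  rw [thetaTerm, thetaTerm, zpow_neg, ← inv_zpow, inv_neg_one]; ring_nf

lemma exists_norm_one_sub_mul_zpow_inv_le {q z : ℂ} (hq0 : q ≠ 0) (hq1 : ‖q‖ < 1) (hz : z ≠ 0) :
    ∃ K : ℝ, ∀ r : ℤ, ‖(1 - z * q ^ (2 * r))⁻¹‖ ≤ K := by
  have hQ := tendsto_pow_atTop_nhds_zero_of_norm_lt_one (norm_sq_lt_one hq1)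
  have h1 : Tendsto (fun n : ℕ => (1 - z * (q ^ 2) ^ n)⁻¹) atTop (nhds 1) := by
    simpa using ((hQ.const_mul z).const_sub 1).inv₀ (by simp)
  have h2 : Tendsto (fun n : ℕ => (q ^ 2) ^ n * ((q ^ 2) ^ n - z)⁻¹) atTop (nhds 0) := by
    simpa using hQ.mul ((hQ.sub_const z).inv₀ (by simpa using hz))
  obtain ⟨K, hK⟩ := (Metric.isBounded_range_of_tendsto _ h1).exists_norm_le
  obtain ⟨M, hM⟩ := (Metric.isBounded_range_of_tendsto _ h2).exists_norm_le
  refine ⟨max K M, fun r => ?_⟩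
  obtain ⟨n, rfl | rfl⟩ := r.eq_nat_or_neg
  · refine le_max_of_le_left ?_
    have hp : q ^ (2 * (n : ℤ)) = (q ^ 2) ^ n := by rw [zpow_mul]; norm_cast
    rw [hp]
    exact hK _ ⟨n, rfl⟩
  · refine le_max_of_le_right ?_
    have hp : q ^ (2 * -(n : ℤ)) = ((q ^ 2) ^ n)⁻¹ := by
      rw [zpow_mul, zpow_neg]; norm_cast
    have hne : (q ^ 2) ^ n ≠ 0 := pow_ne_zero _ (pow_ne_zero _ hq0)
    rw [hp, show 1 - z * ((q ^ 2) ^ n)⁻¹ = ((q ^ 2) ^ n - z) * ((q ^ 2) ^ n)⁻¹ by field_simp,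
      mul_inv, inv_inv, mul_comm]
    exact hM _ ⟨n, rfl⟩

lemma summable_thetaTerm_div {q z : ℂ} (hq0 : q ≠ 0) (hq1 : ‖q‖ < 1) (hz : z ≠ 0) (a : ℤ) :
    Summable fun r => thetaTerm q a r / (1 - z * q ^ (2 * r)) := by
  obtain ⟨K, hK⟩ := exists_norm_one_sub_mul_zpow_inv_le hq0 hq1 hz
  refine Summable.of_norm_bounded ((summable_thetaTerm hq0 hq1 a).norm.mul_right K) fun r => ?_
  rw [div_eq_mul_inv, norm_mul]
  gcongr
  exact hK r

lemma baileyKernel_neg (q : ℂ) (n : ℕ) (r : ℤ) : baileyKernel q n (-r) = baileyKernel q n r := by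
  rw [baileyKernel, baileyKernel, sub_neg_eq_add, ← sub_eq_add_neg, mul_comm]

lemma baileyKernel_zero_left (q : ℂ) {r : ℤ} (hr : r ≠ 0) : baileyKernel q 0 r = 0 := by
  rw [baileyKernel]
  rcases lt_or_gt_of_ne hr with h | h
  · rw [recipPoch_of_neg q (m := (0 : ℕ) + r) (by simpa using h), mul_zero]
  · rw [recipPoch_of_neg q (m := (0 : ℕ) - r) (by simpa using h), zero_mul]

lemma baileyKernel_zero_zero (q : ℂ) : baileyKernel q 0 0 = 1 := by
  simp [baileyKernel, recipPoch_zero]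

lemma tsum_mul_baileyKernel_zero (q : ℂ) (s : ℤ → ℂ) : ∑' r, s r * baileyKernel q 0 r = s 0 := by
  rw [tsum_eq_single 0 fun r hr => by rw [baileyKernel_zero_left q hr, mul_zero],
    baileyKernel_zero_zero, mul_one]

lemma tsum_thetaTerm_neg_mul_baileyKernel (q : ℂ) (a : ℤ) (n : ℕ) :
    ∑' r, thetaTerm q (-a) r * baileyKernel q n r = ∑' r, thetaTerm q a r * baileyKernel q n r := by
  rw [← (Equiv.neg ℤ).tsum_eq]
  exact tsum_congr fun r => by
    rw [Equiv.neg_apply, thetaTerm_neg, neg_neg, baileyKernel_neg]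

/-- Orthogonality of the unit Bailey pair. -/
lemma tsum_thetaTerm_one_mul_baileyKernel {q : ℂ} (hq0 : q ≠ 0) (hq1 : ‖q‖ < 1) {n : ℕ}
    (hn : n ≠ 0) : ∑' r, thetaTerm q 1 r * baileyKernel q n r = 0 := by
  have hc (a : ℤ) := summable_mul_baileyKernel hq1 (summable_thetaTerm hq0 hq1 a) n
  set g : ℤ → ℂ := fun r => thetaTerm q (-1) r * (recipPoch q (n - r) * recipPoch q (n + r - 1))
  have hg : Summable g := by
    obtain ⟨K, hK0, hK⟩ := exists_norm_recipPoch_le hq1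
    refine Summable.of_norm_bounded ((summable_thetaTerm hq0 hq1 (-1)).norm.mul_right (K * K))
      fun r => ?_
    rw [norm_mul, norm_mul]
    gcongr
    exacts [hK _, hK _]
  have hterm (r : ℤ) : g r - g (r + 1) = (1 - q ^ (2 * n)) *
      (thetaTerm q (-1) r * baileyKernel q n r + thetaTerm q 1 r * baileyKernel q n r) := by
    have e1 := recipPoch_sub_one hq1 (n - r)
    have e2 := recipPoch_sub_one hq1 (n + r)
    have c1 : (n : ℤ) - (r + 1) = n - r - 1 := by ring
    have c2 : (n : ℤ) + (r + 1) - 1 = n + r := by ring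
    have p1 : q ^ (2 * ((n : ℤ) - r)) = q ^ (2 * n) / q ^ (2 * r) := by
      rw [mul_sub, zpow_sub₀ hq0]; norm_cast
    have p2 : q ^ (2 * ((n : ℤ) + r)) = q ^ (2 * n) * q ^ (2 * r) := by
      rw [mul_add, zpow_add₀ hq0]; norm_cast
    have t1 : thetaTerm q 1 r = thetaTerm q (-1) r * q ^ (2 * r) := thetaTerm_add hq0 (by norm_num) r
    have t2 : thetaTerm q (-1) (r + 1) = -thetaTerm q 1 r := by
      rw [thetaTerm, thetaTerm, zpow_add_one₀ (by norm_num : (-1 : ℂ) ≠ 0)]; ring_nf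
    rw [p1] at e1
    rw [p2] at e2
    simp only [g, baileyKernel, c1, c2, e1, e2, t2, t1]
    have hR : q ^ (2 * r) ≠ 0 := zpow_ne_zero _ hq0
    generalize q ^ (2 * r) = R at hR
    field_simp
    ring
  have hzero : ∑' r, (g r - g (r + 1)) = 0 := by
    have hg' : Summable fun r => g (r + 1) := hg.comp_injective (add_left_injective 1)
    have hshift := (Equiv.addRight (1 : ℤ)).tsum_eq g
    simp only [Equiv.coe_addRight] at hshift
    rw [hg.tsum_sub hg', hshift, sub_self]
  rw [tsum_congr hterm, tsum_mul_left, (hc (-1)).tsum_add (hc 1),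
    tsum_thetaTerm_neg_mul_baileyKernel, ← two_mul] at hzero
  have hN : 1 - q ^ (2 * n) ≠ 0 := by
    exact_mod_cast one_sub_zpow_ne_zero hq1 (m := ((2 * n : ℕ) : ℤ)) (by omega)
  simpa [hN] using hzero

/-- The partial fraction expansion of `1 / ((z;q²)_{n+1} (q²/z;q²)_n)`. -/
lemma tsum_partial_fraction {q z : ℂ} (hq0 : q ≠ 0) (hq1 : ‖q‖ < 1) (hz : z ≠ 0)
    (hzr : ∀ r : ℤ, 1 - z * q ^ (2 * r) ≠ 0) (n : ℕ) :
    (∑' r, thetaTerm q 1 r / (1 - z * q ^ (2 * r)) * baileyKernel q n r) *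
      (qPochN (z * q ^ 2) (q ^ 2) n * qPochN (z⁻¹ * q ^ 2) (q ^ 2) n) = (1 - z)⁻¹ := by
  induction n with
  | zero => rw [tsum_mul_baileyKernel_zero]; simp [qPochN, thetaTerm]
  | succ n ih =>
    rw [← ih]
    have hV := summable_mul_baileyKernel hq1 (summable_thetaTerm_div hq0 hq1 hz 1) (n + 1)
    have hc (a : ℤ) := summable_mul_baileyKernel hq1 (summable_thetaTerm hq0 hq1 a) (n + 1)
    have hterm (r : ℤ) : thetaTerm q 1 r / (1 - z * q ^ (2 * r)) * baileyKernel q n r =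
        (1 - z * q ^ (2 * (n + 1))) * (1 - z⁻¹ * q ^ (2 * (n + 1))) *
          (thetaTerm q 1 r / (1 - z * q ^ (2 * r)) * baileyKernel q (n + 1) r) -
        q ^ (2 * (n + 1)) * (thetaTerm q (-1) r * baileyKernel q (n + 1) r -
          z⁻¹ * (thetaTerm q 1 r * baileyKernel q (n + 1) r)) := by
      have e1 := recipPoch_sub_one hq1 ((n + 1 : ℕ) - r)
      have e2 := recipPoch_sub_one hq1 ((n + 1 : ℕ) + r)
      have c1 : ((n + 1 : ℕ) : ℤ) - r - 1 = n - r := by push_cast; ring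
      have c2 : ((n + 1 : ℕ) : ℤ) + r - 1 = n + r := by push_cast; ring
      have p1 : q ^ (2 * (((n + 1 : ℕ) : ℤ) - r)) = q ^ (2 * (n + 1)) / q ^ (2 * r) := by
        rw [mul_sub, zpow_sub₀ hq0]; norm_cast
      have p2 : q ^ (2 * (((n + 1 : ℕ) : ℤ) + r)) = q ^ (2 * (n + 1)) * q ^ (2 * r) := by
        rw [mul_add, zpow_add₀ hq0]; norm_cast
      have t1 : thetaTerm q 1 r = thetaTerm q (-1) r * q ^ (2 * r) := thetaTerm_add hq0 (by norm_num) r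
      rw [p1, c1] at e1
      rw [p2, c2] at e2
      simp only [baileyKernel, e1, e2, t1]
      have hR : q ^ (2 * r) ≠ 0 := zpow_ne_zero _ hq0
      have hr := hzr r
      generalize q ^ (2 * r) = R at hR hr
      generalize q ^ (2 * (n + 1)) = N
      generalize recipPoch q ((n + 1 : ℕ) - r) = A
      generalize recipPoch q ((n + 1 : ℕ) + r) = B
      have hd := mul_inv_cancel₀ hr
      field_simp
      linear_combination (thetaTerm q (-1) r * A * B * N * (R - z)) * hd
    rw [tsum_congr hterm, (hV.mul_left _).tsum_sub (((hc (-1)).sub ((hc 1).mul_left _)).mul_left _),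
      tsum_mul_left, tsum_mul_left, (hc (-1)).tsum_sub ((hc 1).mul_left _), tsum_mul_left,
      tsum_thetaTerm_neg_mul_baileyKernel,
      tsum_thetaTerm_one_mul_baileyKernel hq0 hq1 n.succ_ne_zero]
    simp only [qPochN, Finset.prod_range_succ, pow_succ, pow_mul, mul_add]
    ring

lemma columnSum_zero_mul_tsum {q : ℂ} (hq0 : q ≠ 0) (hq1 : ‖q‖ < 1) :
    columnSum q 0 * ∑' r, 2 * (thetaTerm q 2 r / (1 + q ^ (2 * r))) = 1 := by
  have h := tsum_m2Weight_mul_tsum hq1 (summable_thetaTerm hq0 hq1 1)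
  rw [tsum_eq_single 0 fun n hn => by
    rw [tsum_thetaTerm_one_mul_baileyKernel hq0 hq1 hn, mul_zero],
    tsum_mul_baileyKernel_zero] at h
  have h0 : m2Weight q 0 * thetaTerm q 1 0 = 1 := by simp [m2Weight, qPochN, thetaTerm]
  rw [h0] at h
  refine Eq.trans ?_ h.symm
  rw [← tsum_mul_left]
  refine tsum_congr fun r => ?_
  have t : thetaTerm q 2 r = thetaTerm q 1 r * q ^ (1 * r) := thetaTerm_add hq0 (by norm_num) r
  rw [one_mul] at t
  rw [columnSum_eq hq0 hq1 r, t]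
  ring

lemma tsum_thetaTerm_two_div {q : ℂ} (hq0 : q ≠ 0) (hq1 : ‖q‖ < 1) :
    ∑' r, 2 * (thetaTerm q 2 r / (1 + q ^ (2 * r))) = ∑' r, thetaTerm q 0 r := by
  have hs (a : ℤ) : Summable fun r => thetaTerm q a r / (1 + q ^ (2 * r)) := by
    simpa using summable_thetaTerm_div hq0 hq1 (z := -1) (by norm_num) a
  have hne := one_add_zpow_two_mul_ne_zero hq0 hq1
  have t (r : ℤ) : thetaTerm q 2 r = thetaTerm q 0 r * q ^ (2 * r) := thetaTerm_add hq0 (by norm_num) r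
  have hrefl : ∑' r, thetaTerm q 2 r / (1 + q ^ (2 * r)) =
      ∑' r, thetaTerm q 0 r / (1 + q ^ (2 * r)) := by
    rw [← (Equiv.neg ℤ).tsum_eq]
    refine tsum_congr fun r => ?_
    have h2 : thetaTerm q 0 r = thetaTerm q (-2) r * q ^ (2 * r) := thetaTerm_add hq0 (by norm_num) r
    have hR : q ^ (2 * r) ≠ 0 := zpow_ne_zero _ hq0
    have hr := hne r
    have hr' := hne (-r)
    rw [Equiv.neg_apply, thetaTerm_neg, h2]
    rw [mul_neg, zpow_neg] at hr' ⊢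
    generalize q ^ (2 * r) = R at hR hr hr'
    have : R + 1 ≠ 0 := by rwa [add_comm]
    field_simp
    ring
  rw [tsum_mul_left, two_mul]
  nth_rewrite 2 [hrefl]
  rw [← (hs 2).tsum_add (hs 0)]
  refine tsum_congr fun r => ?_
  rw [t]
  field_simp [hne r]
  ring

lemma nStarM2over_eq {q z : ℂ} (hq0 : q ≠ 0) (hq1 : ‖q‖ < 1) (hz : z ≠ 0) (hz1 : 1 + z ≠ 0)
    (hzr : ∀ r : ℤ, 1 - z * q ^ (2 * r) ≠ 0) :
    nStarM2over z q = (1 + z)⁻¹ * (2 * z * (∑' r, thetaTerm q 2 r / (1 - z * q ^ (2 * r))) /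
      (∑' r, thetaTerm q 0 r) + 1) := by
  have h1z : 1 - z ≠ 0 := by simpa using hzr 0
  have hN : nStarM2over z q = ∑' n, m2Weight q n *
      ∑' r, thetaTerm q 1 r / (1 - z * q ^ (2 * r)) * baileyKernel q n r := by
    rw [nStarM2over, nGenM2over, ← tsum_div_const]
    refine tsum_congr fun n => ?_
    have h := tsum_partial_fraction hq0 hq1 hz hzr n
    have hD : qPochN (z * q ^ 2) (q ^ 2) n * qPochN (z⁻¹ * q ^ 2) (q ^ 2) n ≠ 0 := by
      intro h0
      rw [h0, mul_zero] at h
      exact inv_ne_zero h1z h.symm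
    rw [← m2Weight, div_div, div_eq_mul_inv, mul_inv, ← h, mul_comm _⁻¹,
      mul_assoc _ _ (_)⁻¹, mul_inv_cancel₀ hD, mul_one]
  have hC := columnSum_zero_mul_tsum hq0 hq1
  have hΘ := tsum_thetaTerm_two_div hq0 hq1
  rw [hΘ] at hC
  have hs : Summable fun r => 2 * (thetaTerm q 2 r / (1 + q ^ (2 * r))) := by
    simpa using (summable_thetaTerm_div hq0 hq1 (z := -1) (by norm_num) 2).mul_left 2
  have hne := one_add_zpow_two_mul_ne_zero hq0 hq1
  have hterm (r : ℤ) : thetaTerm q 1 r / (1 - z * q ^ (2 * r)) * columnSum q r =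
      columnSum q 0 * (1 + z)⁻¹ * (2 * z * (thetaTerm q 2 r / (1 - z * q ^ (2 * r))) +
        2 * (thetaTerm q 2 r / (1 + q ^ (2 * r)))) := by
    have t : thetaTerm q 2 r = thetaTerm q 1 r * q ^ (1 * r) := thetaTerm_add hq0 (by norm_num) r
    rw [one_mul] at t
    rw [columnSum_eq hq0 hq1 r, t]
    have h1 := hne r
    have h2 := hzr r
    generalize q ^ (2 * r) = R at h1 h2
    field_simp
    ring
  rw [hN, tsum_m2Weight_mul_tsum hq1 (summable_thetaTerm_div hq0 hq1 hz 1), tsum_congr hterm,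
    tsum_mul_left, ((summable_thetaTerm_div hq0 hq1 hz 2).mul_left _).tsum_add hs,
    tsum_mul_left, hΘ]
  have hΘ0 : ∑' r, thetaTerm q 0 r ≠ 0 := right_ne_zero_of_mul_eq_one hC
  rw [eq_div_of_mul_eq hΘ0 hC]
  field_simp

lemma exp_two_pi_zpow (τ : ℂ) (m : ℤ) :
    Complex.exp (2 * π * I * τ) ^ m = Complex.exp (2 * π * I * m * τ) := by
  rw [← Complex.exp_int_mul]; ring_nf

lemma neg_one_zpow_eq_exp (n : ℤ) : (-1 : ℂ) ^ n = Complex.exp (π * I * n) := by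
  rw [← Complex.exp_pi_mul_I, ← Complex.exp_int_mul]; ring_nf

lemma jTheta_self_two_mul (τ : ℂ) :
    jTheta τ (2 * τ) = -I * Complex.exp (-π * I * τ / 2) *
      ∑' r, thetaTerm (Complex.exp (2 * π * I * τ)) 0 r := by
  rw [jTheta, ← tsum_mul_left, ← (Equiv.addRight (1 : ℤ)).tsum_eq (fun r => _ * thetaTerm _ 0 r)]
  refine tsum_congr fun n => ?_
  have hI : (-I : ℂ) = Complex.exp (-(π / 2 * I)) := by
    rw [Complex.exp_neg, Complex.exp_pi_div_two_mul_I, Complex.inv_I]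
  rw [Equiv.coe_addRight, thetaTerm, exp_two_pi_zpow, neg_one_zpow_eq_exp, hI, ← Complex.exp_add,
    ← Complex.exp_add, ← Complex.exp_add]
  congr 1
  push_cast
  ring

lemma lerchMu_two_mul (u τ : ℂ) :
    lerchMu u τ (2 * τ) = Complex.exp (π * I * u) / jTheta τ (2 * τ) *
      ∑' r, thetaTerm (Complex.exp (2 * π * I * τ)) 2 r /
        (1 - Complex.exp (2 * π * I * u) * Complex.exp (2 * π * I * τ) ^ (2 * r)) := by
  rw [lerchMu]
  congr 1
  refine tsum_congr fun n => ?_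
  rw [thetaTerm, exp_two_pi_zpow, exp_two_pi_zpow, ← Complex.exp_add]
  push_cast
  ring_nf

/-- N*(1,1/q,z;q²) in terms of the Lerch sum μ. -/
theorem nStarM2over_lerch (τ u : ℂ) (hτ : 0 < τ.im)
    (hu : ∀ m n : ℤ, u ≠ 2 * (m : ℂ) * τ + (n : ℂ) / 2) :
    nStarM2over (Complex.exp (2 * π * I * u)) (Complex.exp (2 * π * I * τ))
    = (1 + Complex.exp (2 * π * I * u))⁻¹ *
        (-2 * I * Complex.exp (π * I * u) * Complex.exp (-π * I * τ / 2) *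
            lerchMu u τ (2 * τ) + 1) := by
  set q := Complex.exp (2 * π * I * τ) with hq
  set z := Complex.exp (2 * π * I * u) with hzdef
  have hq1 : ‖q‖ < 1 := UpperHalfPlane.norm_exp_two_pi_I_lt_one ⟨τ, hτ⟩
  have key (r : ℤ) (k : ℤ) (h : Complex.exp (2 * π * I * (u + 2 * r * τ + k / 2)) = 1) : False := by
    obtain ⟨m, hm⟩ := Complex.exp_eq_one_iff.mp h
    apply hu (-r) (2 * m - k)
    have h2 := Complex.two_pi_I_ne_zero
    have h3 := mul_left_cancel₀ h2 (hm.trans (mul_comm _ _))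
    push_cast
    linear_combination h3
  have hz1 : 1 + z ≠ 0 := by
    intro h
    refine key 0 1 ?_
    rw [show 2 * π * I * (u + 2 * ((0 : ℤ) : ℂ) * τ + ((1 : ℤ) : ℂ) / 2) = 2 * π * I * u + π * I by
      push_cast; ring, Complex.exp_add, Complex.exp_pi_mul_I]
    linear_combination -h
  have hzr (r : ℤ) : 1 - z * q ^ (2 * r) ≠ 0 := by
    intro h
    refine key r 0 (Eq.trans ?_ (sub_eq_zero.mp h).symm)
    rw [hq, exp_two_pi_zpow, hzdef, ← Complex.exp_add]
    congr 1
    push_cast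
    ring
  rw [nStarM2over_eq (Complex.exp_ne_zero _) hq1 (Complex.exp_ne_zero _) hz1 hzr, lerchMu_two_mul,
    jTheta_self_two_mul, ← hq, ← hzdef]
  have hzz : z = Complex.exp (π * I * u) * Complex.exp (π * I * u) := by
    rw [← Complex.exp_add, hzdef]; ring_nf
  have hE := Complex.exp_ne_zero (-π * I * τ / 2)
  congr 2
  generalize ∑' r, thetaTerm q 2 r / (1 - z * q ^ (2 * r)) = S
  rw [hzz]
  field_simp

end
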